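/- Let U be a tree of finite sequences of natural numbers, and for σ, τ ∈ U⁺ with τ <KB σ define L(σ, τ) := l(ν), where ν is the initial segment of τ of length |σ ⊓ τ| + 1. Then L is an acceptable copy-length function: (i) for every σ ∈ U and every n ∈ ℕ, σ⌢⟨n⟩ ∈ U⁺, σ⌢⟨n⟩ <KB σ, and L(σ, σ⌢⟨n⟩) = l(σ) + 4(n+1); in particular L(σ, σ⌢⟨n⟩) → ∞ as n → ∞; and (ii) whenever τ, τ′, σ′, σ ∈ U⁺ satisfy τ ≤KB τ′ <KB σ′ ≤KB σ, one has L(σ′, τ′) ≥ L(σ, τ). -/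

import Mathlib

/-- A tree: a set of finite sequences closed under initial segments. -/
def IsTree (T : Set (List ℕ)) : Prop := ∀ σ ∈ T, ∀ τ, τ <+: σ → τ ∈ T

/-- `T⁺ = T ∪ { σ⌢⟨n⟩ : σ ∈ T, n ∈ ℕ }`. -/
def treePlus (T : Set (List ℕ)) : Set (List ℕ) :=
  T ∪ {σ | ∃ τ ∈ T, ∃ n : ℕ, σ = τ ++ [n]}

/-- `σ` is left of `τ` (finite sequences). -/
def LeftOf (σ τ : List ℕ) : Prop := ∃ ρ x y, x < y ∧ ρ ++ [x] <+: σ ∧ ρ ++ [y] <+: τ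

/-- The Kleene–Brouwer order: `σ <KB τ` iff `σ` properly extends `τ` or `σ` is left
of `τ`. -/
def KBlt (σ τ : List ℕ) : Prop := (τ <+: σ ∧ σ ≠ τ) ∨ LeftOf σ τ

/-- Non-strict Kleene–Brouwer order. -/
def KBle (σ τ : List ℕ) : Prop := KBlt σ τ ∨ σ = τ

/-- The longest common initial segment of two finite sequences. -/
def listMeet : List ℕ → List ℕ → List ℕ
  | a :: s, b :: t => if a = b then a :: listMeet s t else []
  | _, _ => []

/-- `l(ρ) = Σ_{i<|ρ|} 4(ρ(i)+1)`. -/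
def lval (ρ : List ℕ) : ℕ := (ρ.map (fun x => 4 * (x + 1))).sum

/-- `L(σ, τ) = l(ν)` where `ν` is the initial segment of `τ` of length
`|σ ⊓ τ| + 1`. -/
def copyLen (σ τ : List ℕ) : ℕ := lval (τ.take ((listMeet σ τ).length + 1))

theorem not_kBlt_nil (t : List ℕ) : ¬ KBlt [] t := by
  rintro (⟨h, hne⟩ | ⟨ρ, x, y, -, h, -⟩)
  · exact hne (List.prefix_nil.mp h).symm
  · simp at h

theorem leftOf_cons_cons {a b : ℕ} {s t : List ℕ} :
    LeftOf (a :: s) (b :: t) ↔ a < b ∨ a = b ∧ LeftOf s t := by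
  constructor
  · rintro ⟨ρ, x, y, hxy, hs, ht⟩
    cases ρ with
    | nil =>
      simp only [List.nil_append, List.cons_prefix_cons] at hs ht
      left
      rw [← hs.1, ← ht.1]
      exact hxy
    | cons c ρ =>
      simp only [List.cons_append, List.cons_prefix_cons] at hs ht
      exact Or.inr ⟨hs.1.symm.trans ht.1, ρ, x, y, hxy, hs.2, ht.2⟩
  · rintro (h | ⟨rfl, ρ, x, y, hxy, hs, ht⟩)
    · exact ⟨[], a, b, h, by simp, by simp⟩
    · exact ⟨a :: ρ, x, y, hxy, by simpa using hs, by simpa using ht⟩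

theorem kBlt_cons_cons {a b : ℕ} {s t : List ℕ} :
    KBlt (a :: s) (b :: t) ↔ a < b ∨ a = b ∧ KBlt s t := by
  simp only [KBlt, leftOf_cons_cons, List.cons_prefix_cons, ne_eq, List.cons.injEq]
  grind

theorem KBlt.trans {s t u : List ℕ} (hst : KBlt s t) (htu : KBlt t u) : KBlt s u := by
  induction s generalizing t u with
  | nil => exact absurd hst (not_kBlt_nil t)
  | cons a s ih =>
    cases t with
    | nil => exact absurd htu (not_kBlt_nil u)
    | cons b t =>
      cases u with
      | nil => exact Or.inl ⟨List.nil_prefix, by simp⟩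
      | cons c u =>
        rw [kBlt_cons_cons] at *
        grind

theorem copyLen_nil_cons (b : ℕ) (t : List ℕ) : copyLen [] (b :: t) = 4 * (b + 1) := by
  simp [copyLen, listMeet, lval]

theorem copyLen_cons_cons (a b : ℕ) (s t : List ℕ) :
    copyLen (a :: s) (b :: t) = 4 * (b + 1) + if a = b then copyLen s t else 0 := by
  by_cases h : a = b <;> simp [copyLen, listMeet, lval, h]

/-- Moving the left endpoint to the right does not decrease the copy length. -/
theorem copyLen_le_of_left {s t t' : List ℕ} (h : KBlt t t') (h' : KBlt t' s) :
    copyLen s t ≤ copyLen s t' := by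
  induction s generalizing t t' with
  | nil =>
    match t, t', h, h' with
    | [], _, h, _ => exact absurd h (not_kBlt_nil _)
    | _ :: _, [], _, h' => exact absurd h' (not_kBlt_nil _)
    | b :: t, b' :: t', h, _ =>
      rw [kBlt_cons_cons] at h
      rw [copyLen_nil_cons, copyLen_nil_cons]
      omega
  | cons c s ih =>
    match t, t', h, h' with
    | [], _, h, _ => exact absurd h (not_kBlt_nil _)
    | _ :: _, [], _, h' => exact absurd h' (not_kBlt_nil _)
    | b :: t, b' :: t', h, h' =>
      rw [kBlt_cons_cons] at h h'
      rw [copyLen_cons_cons, copyLen_cons_cons]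
      grind

/-- Moving the right endpoint to the left does not decrease the copy length. -/
theorem copyLen_le_of_right {t s' s : List ℕ} (h : KBlt t s') (h' : KBlt s' s) :
    copyLen s t ≤ copyLen s' t := by
  induction t generalizing s' s with
  | nil => exact absurd h (not_kBlt_nil _)
  | cons b t ih =>
    match s', s, h, h' with
    | [], _, _, h' => exact absurd h' (not_kBlt_nil _)
    | c' :: s', [], _, _ =>
      rw [copyLen_nil_cons, copyLen_cons_cons]
      omega
    | c' :: s', c :: s, h, h' =>
      rw [kBlt_cons_cons] at h h'
      rw [copyLen_cons_cons, copyLen_cons_cons]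
      grind

theorem copyLen_append_singleton (s : List ℕ) (n : ℕ) :
    copyLen s (s ++ [n]) = lval s + 4 * (n + 1) := by
  induction s with
  | nil => simp [copyLen_nil_cons, lval]
  | cons a s ih =>
    rw [List.cons_append, copyLen_cons_cons, if_pos rfl, ih]
    simp [lval, add_assoc]


/-- `L` is an acceptable copy-length function: (i) for `σ ∈ U` and `n ∈ ℕ`,
`σ⌢⟨n⟩ ∈ U⁺`, `σ⌢⟨n⟩ <KB σ` and `L(σ, σ⌢⟨n⟩) = l(σ) + 4(n+1)`, so
`L(σ, σ⌢⟨n⟩) → ∞`; and (ii) `L` is antitone in intervals: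
`τ ≤KB τ′ <KB σ′ ≤KB σ` implies `L(σ′, τ′) ≥ L(σ, τ)`. -/
theorem stmt11 (U : Set (List ℕ)) (hU : IsTree U) :
    (∀ σ ∈ U, ∀ n : ℕ,
      (σ ++ [n]) ∈ treePlus U ∧ KBlt (σ ++ [n]) σ ∧
      copyLen σ (σ ++ [n]) = lval σ + 4 * (n + 1)) ∧
    (∀ σ ∈ U,
      Filter.Tendsto (fun n : ℕ => copyLen σ (σ ++ [n])) Filter.atTop Filter.atTop) ∧
    (∀ τ τ' σ' σ : List ℕ,
      τ ∈ treePlus U → τ' ∈ treePlus U → σ' ∈ treePlus U → σ ∈ treePlus U →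
      KBle τ τ' → KBlt τ' σ' → KBle σ' σ →
      copyLen σ τ ≤ copyLen σ' τ') := by
  refine ⟨fun σ hσ n => ⟨Or.inr ⟨σ, hσ, n, rfl⟩, Or.inl ⟨List.prefix_append σ [n], by simp⟩,
    copyLen_append_singleton σ n⟩, fun σ _ => ?_, ?_⟩
  · simp only [copyLen_append_singleton]
    exact Filter.tendsto_atTop_mono (fun n => by rw [id]; omega) Filter.tendsto_id
  · rintro τ τ' σ' σ - - - - hτ h hσ
    have hleft : copyLen σ' τ ≤ copyLen σ' τ' := by
      rcases hτ with hτ | rfl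
      · exact copyLen_le_of_left hτ h
      · exact le_rfl
    have hlt : KBlt τ σ' := by
      rcases hτ with hτ | rfl
      · exact hτ.trans h
      · exact h
    rcases hσ with hσ | rfl
    · exact (copyLen_le_of_right hlt hσ).trans hleft
    · exact hleft
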